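/- Let r ∈ (0, 1/36) and p ∈ (0, r). For each m, n ≥ 0, the set Δ_mn(p,r) of all q in D_mn(p,r) = (a·r^{n+1}/p^m, r) for which there exist i ∈ {2,...,6} and j ∈ {1,...,5} with S_3(S_1^m(K_i(p,q,r))) ∩ S_4(S_6^n(K_j(p,q,r))) ≠ ∅ is a closed subset of D_mn(p,r), and its Hausdorff dimension is at most −2·log 6/log r. -/

import Mathlib

open Set

/-- The system `S_pqr = {S_1,…,S_6}` of similarities of `ℝ` (0-indexed: index `i : Fin 6`
corresponds to `S_{i+1}`), with `a = 1/5` and `h = 8/15`. -/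
noncomputable def Spqr (p q r : ℝ) : Fin 6 → ℝ → ℝ :=
  ![fun x => p * x,
    fun x => 1/5 + r * x,
    fun x => 8/15 - q * x,
    fun x => 8/15 - r + r * x,
    fun x => 1 - 1/5 - r * x,
    fun x => 1 - r + r * x]

/-- `K` is the attractor of the system `T`. -/
def IsAttractor (T : Fin 6 → ℝ → ℝ) (K : Set ℝ) : Prop :=
  K.Nonempty ∧ IsCompact K ∧ K = ⋃ i, T i '' K

open Filter Topology MeasureTheory Metric in
/-- A set which for every `k` is covered by `N ^ k` sets of diameter at most `C * r ^ k` has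
Hausdorff dimension at most `log N / (-log r)`. -/
theorem dimH_le_of_pow_cover {X : Type*} [EMetricSpace X] {s : Set X} {N : ℕ} (hN : 1 ≤ N)
    {C r : ℝ} (hC : 0 ≤ C) (hr0 : 0 < r) (hr1 : r < 1) {ι : ℕ → Type*} [∀ k, Fintype (ι k)]
    (hι : ∀ k, Fintype.card (ι k) = N ^ k) (t : ∀ k, ι k → Set X)
    (hdiam : ∀ k i, ediam (t k i) ≤ ENNReal.ofReal (C * r ^ k)) (hst : ∀ k, s ⊆ ⋃ i, t k i) :
    dimH s ≤ ENNReal.ofReal (Real.log N / -Real.log r) := by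
  borelize X
  set d : ℝ := Real.log N / -Real.log r with hd
  have hlog : Real.log r < 0 := Real.log_neg hr0 hr1
  have hd0 : 0 ≤ d := div_nonneg (Real.log_natCast_nonneg N) (by linarith)
  have hN0 : (0 : ℝ) < N := by exact_mod_cast hN
  have hrd : (N : ℝ) * r ^ d = 1 := by
    have h : Real.log r * d = -Real.log N := by
      rw [hd, div_neg, mul_neg, mul_div_cancel₀ _ hlog.ne]
    rw [Real.rpow_def_of_pos hr0, h, Real.exp_neg, Real.exp_log hN0, mul_inv_cancel₀ hN0.ne']
  refine dimH_le_of_hausdorffMeasure_ne_top (d := d.toNNReal) ?_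
  rw [Real.coe_toNNReal d hd0]
  have hlim : Tendsto (fun k : ℕ => ENNReal.ofReal (C * r ^ k)) atTop (𝓝 0) := by
    have h := ENNReal.tendsto_ofReal
      ((tendsto_pow_atTop_nhds_zero_of_lt_one hr0.le hr1).const_mul C)
    simpa using h
  have hsum : ∀ k, ∑ i, ediam (t k i) ^ d ≤ ENNReal.ofReal (C ^ d) := by
    intro k
    calc ∑ i, ediam (t k i) ^ d ≤ ∑ _i : ι k, ENNReal.ofReal (C * r ^ k) ^ d :=
          Finset.sum_le_sum fun i _ => ENNReal.rpow_le_rpow (hdiam k i) hd0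
      _ = ENNReal.ofReal (N ^ k * (C * r ^ k) ^ d) := by
          rw [Finset.sum_const, Finset.card_univ, hι, nsmul_eq_mul,
            ENNReal.ofReal_rpow_of_nonneg (by positivity) hd0,
            ENNReal.ofReal_mul (by positivity), ENNReal.ofReal_pow (by positivity),
            ENNReal.ofReal_natCast, Nat.cast_pow]
      _ = ENNReal.ofReal (C ^ d) := by
          rw [Real.mul_rpow hC (by positivity), ← Real.rpow_pow_comm hr0.le, mul_left_comm,
            ← mul_pow, hrd, one_pow, mul_one]
  refine ne_top_of_le_ne_top (ENNReal.ofReal_ne_top (r := C ^ d))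
    ((Measure.hausdorffMeasure_le_liminf_sum d s _ hlim t (.of_forall hdiam)
      (.of_forall hst)).trans ?_)
  exact (liminf_le_liminf (.of_forall hsum)).trans_eq (liminf_const _)

/-- The image of `K` under the composition of the maps of `T` along the word `w`. -/
def cylinder (T : Fin 6 → ℝ → ℝ) (K : Set ℝ) : (k : ℕ) → (Fin k → Fin 6) → Set ℝ
  | 0, _ => K
  | k + 1, w => T (w 0) '' cylinder T K k (Fin.tail w)

theorem IsAttractor.image_subset {T : Fin 6 → ℝ → ℝ} {K : Set ℝ} (h : IsAttractor T K)
    (i : Fin 6) : T i '' K ⊆ K := by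
  conv_rhs => rw [h.2.2]
  exact subset_iUnion (fun i => T i '' K) i

theorem IsAttractor.exists_eq {T : Fin 6 → ℝ → ℝ} {K : Set ℝ} (h : IsAttractor T K) {x : ℝ}
    (hx : x ∈ K) : ∃ i, ∃ u ∈ K, T i u = x := by
  rw [h.2.2] at hx
  simpa using hx

theorem IsAttractor.exists_mem_cylinder {T : Fin 6 → ℝ → ℝ} {K : Set ℝ} (h : IsAttractor T K)
    (k : ℕ) : ∀ x ∈ K, ∃ w, x ∈ cylinder T K k w := by
  induction k with
  | zero => exact fun x hx => ⟨Fin.elim0, hx⟩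
  | succ k ih =>
    intro x hx
    obtain ⟨i, u, hu, rfl⟩ := h.exists_eq hx
    obtain ⟨w, hw⟩ := ih u hu
    exact ⟨Fin.cons i w, u, by simpa using hw, by simp⟩

theorem IsAttractor.cylinder_subset {T : Fin 6 → ℝ → ℝ} {K : Set ℝ} (h : IsAttractor T K)
    (k : ℕ) (w : Fin k → Fin 6) : cylinder T K k w ⊆ K := by
  induction k with
  | zero => exact subset_rfl
  | succ k ih => exact (image_mono (ih _)).trans (h.image_subset _)

section Spqr

variable {p q q' r : ℝ}

theorem iterate_Spqr_zero (m : ℕ) (x : ℝ) : (Spqr p q r 0)^[m] x = p ^ m * x := by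
  induction m with
  | zero => simp
  | succ m ih =>
    rw [Function.iterate_succ_apply', ih]
    simp only [Spqr, Matrix.cons_val]
    ring

theorem iterate_Spqr_five (n : ℕ) (x : ℝ) : (Spqr p q r 5)^[n] x = 1 - r ^ n * (1 - x) := by
  induction n with
  | zero => simp
  | succ n ih =>
    rw [Function.iterate_succ_apply', ih]
    simp only [Spqr, Matrix.cons_val]
    ring

/-- The overlap condition defining `Δ_mn(p,r)` as an equation in the two points coded. -/
theorem overlap_nonempty_iff (m n : ℕ) (i j : Fin 6) (K : Set ℝ) :
    ((Spqr p q r 2 '' ((Spqr p q r 0)^[m] '' (Spqr p q r i '' K))) ∩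
      (Spqr p q r 3 '' ((Spqr p q r 5)^[n] '' (Spqr p q r j '' K)))).Nonempty ↔
    ∃ u ∈ K, ∃ v ∈ K,
      q * (p ^ m * Spqr p q r i u) = r ^ (n + 1) * (1 - Spqr p q r j v) := by
  have h2 : ∀ x, Spqr p q r 2 x = 8/15 - q * x := fun x => by simp [Spqr]
  have h3 : ∀ x, Spqr p q r 3 x = 8/15 - r + r * x := fun x => by simp [Spqr]
  constructor
  · rintro ⟨_, ⟨_, ⟨_, ⟨u, hu, rfl⟩, rfl⟩, rfl⟩, ⟨_, ⟨_, ⟨v, hv, rfl⟩, rfl⟩, h⟩⟩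
    rw [iterate_Spqr_five, iterate_Spqr_zero, h2, h3] at h
    exact ⟨u, hu, v, hv, by linear_combination h⟩
  · rintro ⟨u, hu, v, hv, h⟩
    refine ⟨_, ⟨_, ⟨_, ⟨u, hu, rfl⟩, rfl⟩, rfl⟩, ⟨_, ⟨_, ⟨v, hv, rfl⟩, rfl⟩, ?_⟩⟩
    rw [iterate_Spqr_five, iterate_Spqr_zero, h2, h3]
    linear_combination h

theorem one_fifth_le_Spqr (hr : r ∈ Ioo (0:ℝ) (1/36)) (hq : q ∈ Ioo (0:ℝ) (1/36)) {x : ℝ}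
    (hx : x ∈ Icc (0:ℝ) 1) {i : Fin 6} (hi : i ≠ 0) : 1/5 ≤ Spqr p q r i x := by
  obtain ⟨hr0, hr1⟩ := hr
  obtain ⟨hq0, hq1⟩ := hq
  obtain ⟨hx0, hx1⟩ := hx
  have := mul_nonneg hr0.le hx0
  have := mul_le_mul hr1.le hx1 hx0 (by norm_num)
  have := mul_le_mul hq1.le hx1 hx0 (by norm_num)
  fin_cases i <;> simp [Spqr] at hi ⊢ <;> linarith

theorem abs_Spqr_sub_half_le (hr : r ∈ Ioo (0:ℝ) (1/36)) (hp : p ∈ Ioo (0:ℝ) r)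
    (hq : q ∈ Ioo (0:ℝ) (1/36)) {x R : ℝ} (hR : 1/2 ≤ R) (hx : |x - 1/2| ≤ R) (i : Fin 6) :
    |Spqr p q r i x - 1/2| ≤ 1/2 + 1/36 * (R - 1/2) := by
  obtain ⟨hr0, hr1⟩ := hr
  obtain ⟨hp0, hp1⟩ := hp
  obtain ⟨hq0, hq1⟩ := hq
  rw [abs_le] at hx ⊢
  obtain ⟨hx0, hx1⟩ := hx
  have key : ∀ s, 0 < s → s < 1/36 → s * (x - 1) ≤ 1/36 * (R - 1/2) ∧
      -(1/36 * (R - 1/2)) ≤ s * x := by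
    intro s hs0 hs1
    constructor
    · nlinarith
    · nlinarith
  have hxr := key r hr0 hr1
  have hxq := key q hq0 hq1
  have hxp := key p hp0 (hp1.trans hr1)
  fin_cases i <;> simp [Spqr] <;> constructor <;> linarith

theorem IsAttractor.subset_Icc (hr : r ∈ Ioo (0:ℝ) (1/36)) (hp : p ∈ Ioo (0:ℝ) r)
    (hq : q ∈ Ioo (0:ℝ) (1/36)) {K : Set ℝ} (hK : IsAttractor (Spqr p q r) K) :
    K ⊆ Icc 0 1 := by
  obtain ⟨x, hx, hmax⟩ := hK.2.1.exists_isMaxOn hK.1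
    (f := fun x => |x - 1/2|) (by fun_prop)
  have hxle : |x - 1/2| ≤ 1/2 := by
    by_contra! h
    obtain ⟨i, u, hu, rfl⟩ := hK.exists_eq hx
    have := abs_Spqr_sub_half_le hr hp hq h.le (hmax hu) i
    linarith
  intro y hy
  have := abs_le.1 ((hmax hy : |y - 1/2| ≤ |x - 1/2|).trans hxle)
  constructor <;> linarith

/-- Dependence of the maps on both the parameter `q` and the point. -/
theorem abs_Spqr_sub_Spqr_le (hp : p ∈ Ioo (0:ℝ) r) (hq' : q' ∈ Ioo (0:ℝ) r)
    {x x' : ℝ} (hx : x ∈ Icc (0:ℝ) 1) (i : Fin 6) :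
    |Spqr p q r i x - Spqr p q' r i x'| ≤ |q - q'| + r * |x - x'| := by
  have h0 := abs_nonneg (q - q')
  have h1 := abs_nonneg (x - x')
  have hr0 : 0 < r := hp.1.trans hp.2
  have hrr : |r * (x - x')| = r * |x - x'| := by rw [abs_mul, abs_of_pos hr0]
  fin_cases i
  · calc _ = |p * (x - x')| := by simp [Spqr, mul_sub]
      _ = p * |x - x'| := by rw [abs_mul, abs_of_pos hp.1]
      _ ≤ r * |x - x'| := by gcongr; exact hp.2.le
      _ ≤ _ := by linarith
  · calc _ = |r * (x - x')| := by simp [Spqr, mul_sub]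
      _ ≤ _ := by linarith
  · calc _ = |(q' - q) * x + q' * (x' - x)| := by simp [Spqr]; ring_nf
      _ ≤ |(q' - q) * x| + |q' * (x' - x)| := abs_add_le _ _
      _ = |q - q'| * x + q' * |x - x'| := by
        rw [abs_mul, abs_mul, abs_of_pos hq'.1, abs_of_nonneg hx.1, abs_sub_comm q', abs_sub_comm x']
      _ ≤ _ := add_le_add (mul_le_of_le_one_right h0 hx.2) (by gcongr; exact hq'.2.le)
  · calc _ = |r * (x - x')| := by simp [Spqr, mul_sub]
      _ ≤ _ := by linarith
  · calc _ = |r * (x' - x)| := congrArg abs (by simp [Spqr]; ring)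
      _ = r * |x - x'| := by rw [abs_mul, abs_of_pos hr0, abs_sub_comm]
      _ ≤ _ := by linarith
  · calc _ = |r * (x - x')| := by simp [Spqr, mul_sub]
      _ ≤ _ := by linarith

/-- Points of the two attractors with a common code of length `k` are close. -/
theorem abs_sub_le_of_mem_cylinder (hr : r ∈ Ioo (0:ℝ) (1/36)) (hp : p ∈ Ioo (0:ℝ) r)
    (hq : q ∈ Ioo (0:ℝ) r) (hq' : q' ∈ Ioo (0:ℝ) r) {K K' : Set ℝ}
    (hK : IsAttractor (Spqr p q r) K) (hK' : IsAttractor (Spqr p q' r) K') (k : ℕ)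
    (w : Fin k → Fin 6) : ∀ x ∈ cylinder (Spqr p q r) K k w,
      ∀ x' ∈ cylinder (Spqr p q' r) K' k w, |x - x'| ≤ 36/35 * |q - q'| + r ^ k := by
  have hKI := hK.subset_Icc hr hp ⟨hq.1, hq.2.trans hr.2⟩
  have hKI' := hK'.subset_Icc hr hp ⟨hq'.1, hq'.2.trans hr.2⟩
  have h0 := abs_nonneg (q - q')
  induction k with
  | zero =>
    intro x hx x' hx'
    have hx := hKI hx
    have hx' := hKI' hx'
    have : |x - x'| ≤ 1 := abs_le.2 ⟨by linarith [hx.1, hx'.2], by linarith [hx.2, hx'.1]⟩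
    rw [pow_zero]
    linarith
  | succ k ih =>
    rintro _ ⟨u, hu, rfl⟩ _ ⟨u', hu', rfl⟩
    have h := ih _ u hu u' hu'
    have hS := abs_Spqr_sub_Spqr_le (q := q) hp hq' (x' := u')
      (hKI (hK.cylinder_subset _ _ hu)) (w 0)
    have h1 := mul_le_mul_of_nonneg_left h hr.1.le
    have h2 := mul_le_mul_of_nonneg_right hr.2.le h0
    rw [pow_succ']
    linarith

/-- The attractor depends Lipschitz continuously on `q`. -/
theorem exists_mem_attractor_abs_sub_le (hr : r ∈ Ioo (0:ℝ) (1/36)) (hp : p ∈ Ioo (0:ℝ) r)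
    (hq : q ∈ Ioo (0:ℝ) r) (hq' : q' ∈ Ioo (0:ℝ) r) {K K' : Set ℝ}
    (hK : IsAttractor (Spqr p q r) K) (hK' : IsAttractor (Spqr p q' r) K') {x' : ℝ}
    (hx' : x' ∈ K') : ∃ x ∈ K, |x - x'| ≤ 36/35 * |q - q'| := by
  have hKI := hK.subset_Icc hr hp ⟨hq.1, hq.2.trans hr.2⟩
  have h0 := abs_nonneg (q - q')
  obtain ⟨z, hz, hmax⟩ := hK'.2.1.exists_isMaxOn hK'.1
    (f := fun x => Metric.infDist x K) (Metric.continuous_infDist_pt K).continuousOn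
  have hzle : Metric.infDist z K ≤ 36/35 * |q - q'| := by
    obtain ⟨i, u', hu', rfl⟩ := hK'.exists_eq hz
    obtain ⟨u, hu, hd⟩ := hK.2.1.exists_infDist_eq_dist hK.1 u'
    have hS := abs_Spqr_sub_Spqr_le (q := q) hp hq' (x' := u') (hKI hu) i
    have h1 := Metric.infDist_le_dist_of_mem (x := Spqr p q' r i u')
      (hK.image_subset i (mem_image_of_mem _ hu))
    have h2 : Metric.infDist u' K ≤ Metric.infDist (Spqr p q' r i u') K := hmax hu'
    rw [dist_comm, Real.dist_eq] at h1 hd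
    rw [hd] at h2
    have h3 := mul_le_mul_of_nonneg_right hr.2.le (abs_nonneg (u - u'))
    linarith
  obtain ⟨x, hx, hd⟩ := hK.2.1.exists_infDist_eq_dist hK.1 x'
  refine ⟨x, hx, ?_⟩
  rw [← Real.dist_eq, dist_comm, ← hd]
  exact (hmax hx').trans hzle

/-- The graph of `q ↦ K q` is closed over any family of parameters in `(0, r)`. -/
theorem isClosed_setOf_mem_attractor (hr : r ∈ Ioo (0:ℝ) (1/36)) (hp : p ∈ Ioo (0:ℝ) r)
    {D : Set ℝ} (hD : D ⊆ Ioo 0 r) {K : ℝ → Set ℝ}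
    (hK : ∀ q ∈ D, IsAttractor (Spqr p q r) (K q)) :
    IsClosed {z : D × ℝ | z.2 ∈ K z.1} := by
  refine isClosed_of_closure_subset fun z hz => ?_
  have hKz := hK z.1 z.1.2
  change z.2 ∈ K z.1
  rw [← hKz.2.1.isClosed.closure_eq, Metric.mem_closure_iff]
  intro ε hε
  obtain ⟨z', hz', hd⟩ := Metric.mem_closure_iff.1 hz (ε / 3) (by linarith)
  obtain ⟨x, hx, hxd⟩ := exists_mem_attractor_abs_sub_le hr hp (hD z.1.2) (hD z'.1.2) hKz
    (hK z'.1 z'.1.2) hz'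
  rw [Prod.dist_eq, max_lt_iff, Subtype.dist_eq, Real.dist_eq] at hd
  refine ⟨x, hx, ?_⟩
  have h1 := dist_triangle z.2 z'.2 x
  rw [dist_comm z'.2 x, Real.dist_eq x] at h1
  linarith [hd.1, hd.2]

/-- Solutions of the overlap equation whose points have common codes of length `k` are
close. -/
theorem abs_sub_le_of_overlap (hr : r ∈ Ioo (0:ℝ) (1/36)) {A B x x' y y' δ : ℝ}
    (hA : 0 < A) (hBA : B ≤ 5 * r * A) (hB : 0 ≤ B) (hq' : q' ∈ Ioo (0:ℝ) r)
    (h : q * (A * x) = B * (1 - y)) (h' : q' * (A * x') = B * (1 - y'))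
    (hx : 1/5 ≤ x) (hxx : |x - x'| ≤ 36/35 * |q - q'| + δ)
    (hyy : |y - y'| ≤ 36/35 * |q - q'| + δ) : |q - q'| ≤ 6 * δ := by
  have e : A * ((q - q') * x) = B * (y' - y) + A * (q' * (x' - x)) := by
    linear_combination h - h'
  have h1 : A * (|q - q'| * x) ≤ B * |y - y'| + A * (q' * |x - x'|) := by
    calc A * (|q - q'| * x) = |A * ((q - q') * x)| := by
          rw [abs_mul, abs_mul, abs_of_pos hA, abs_of_pos (a := x) (by linarith)]
      _ ≤ |B * (y' - y)| + |A * (q' * (x' - x))| := by rw [e]; exact abs_add_le _ _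
      _ = _ := by
          rw [abs_mul, abs_mul A, abs_mul q', abs_of_nonneg hB, abs_of_pos hA,
            abs_of_pos hq'.1, abs_sub_comm x', abs_sub_comm y']
  have hM : 0 ≤ 36/35 * |q - q'| + δ := (abs_nonneg _).trans hxx
  set M := 36/35 * |q - q'| + δ with hMdef
  have h2 : B * |y - y'| ≤ A * (5/36 * M) := by
    calc B * |y - y'| ≤ (A * (5/36)) * M := by
          gcongr
          nlinarith [hr.2]
      _ = _ := by ring
  have h3 : A * (q' * |x - x'|) ≤ A * (1/36 * M) := by
    gcongr
    exact (hq'.2.trans hr.2).le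
  have h4 : |q - q'| * (1/5) ≤ |q - q'| * x := by gcongr
  have h5 : |q - q'| * x ≤ 5/36 * M + 1/36 * M :=
    le_of_mul_le_mul_left (by linarith) hA
  linarith

end Spqr

/-- For `r ∈ (0,1/36)`, `p ∈ (0,r)` and `m, n ≥ 0`, the set `Δ_mn(p,r)` of those
`q ∈ D_mn(p,r) = (a·rⁿ⁺¹/pᵐ, r)` (`a = 1/5`) for which `S₃ S₁^m (K_i)` meets
`S₄ S₆^n (K_j)` for some `i ≠ 1`, `j ≠ 6` (0-indexed: `i ≠ 0`, `j ≠ 5`) is a closed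
subset of `D_mn(p,r)` of Hausdorff dimension at most `−2·log 6/log r`. -/
theorem stmt13 (r p : ℝ) (hr : r ∈ Ioo (0:ℝ) (1/36)) (hp : p ∈ Ioo (0:ℝ) r)
    (K : ℝ → Set ℝ) (hK : ∀ q ∈ Ioo (0:ℝ) (1/36), IsAttractor (Spqr p q r) (K q))
    (m n : ℕ) :
    IsClosed {x : Ioo ((1/5) * r^(n+1) / p^m) r | ∃ i j : Fin 6, i ≠ 0 ∧ j ≠ 5 ∧
      ((Spqr p (↑x) r 2 '' ((Spqr p (↑x) r 0)^[m] '' (Spqr p (↑x) r i '' K ↑x))) ∩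
        (Spqr p (↑x) r 3 '' ((Spqr p (↑x) r 5)^[n] '' (Spqr p (↑x) r j '' K ↑x)))).Nonempty} ∧
    dimH {q ∈ Ioo ((1/5) * r^(n+1) / p^m) r | ∃ i j : Fin 6, i ≠ 0 ∧ j ≠ 5 ∧
      ((Spqr p q r 2 '' ((Spqr p q r 0)^[m] '' (Spqr p q r i '' K q))) ∩
        (Spqr p q r 3 '' ((Spqr p q r 5)^[n] '' (Spqr p q r j '' K q)))).Nonempty} ≤
      ENNReal.ofReal (-2 * Real.log 6 / Real.log r) := by
  set D := Ioo ((1/5) * r^(n+1) / p^m) r with hD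
  have hA : 0 < p ^ m := pow_pos hp.1 m
  have hB : 0 < r ^ (n + 1) := pow_pos hr.1 _
  have hDr : D ⊆ Ioo 0 r := fun q hq => ⟨lt_trans (by positivity) hq.1, hq.2⟩
  have hD36 : D ⊆ Ioo 0 (1/36) := fun q hq => ⟨(hDr hq).1, hq.2.trans hr.2⟩
  have hKI : ∀ q ∈ D, K q ⊆ Icc 0 1 := fun q hq =>
    (hK q (hD36 hq)).subset_Icc hr hp (hD36 hq)
  simp only [overlap_nonempty_iff]
  constructor
  · simp only [ofPred_exists, ofPred_and]
    refine isClosed_iUnion_of_finite fun i => isClosed_iUnion_of_finite fun j =>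
      isClosed_const.inter (isClosed_const.inter ?_)
    have hgraph := isClosed_setOf_mem_attractor hr hp hDr fun q hq => hK q (hD36 hq)
    have hcont : ∀ i, Continuous fun z : D × ℝ => Spqr p z.1 r i z.2 := by
      intro i
      fin_cases i <;> simp [Spqr] <;> fun_prop
    have hclosed : IsClosed {z : D × (Icc (0:ℝ) 1 × Icc (0:ℝ) 1) |
        (z.2.1 : ℝ) ∈ K z.1 ∧ (z.2.2 : ℝ) ∈ K z.1 ∧
        (z.1 : ℝ) * (p ^ m * Spqr p z.1 r i z.2.1) =
          r ^ (n + 1) * (1 - Spqr p z.1 r j z.2.2)} := by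
      have h1 : Continuous fun z : D × (Icc (0:ℝ) 1 × Icc (0:ℝ) 1) => (z.1, (z.2.1 : ℝ)) := by
        fun_prop
      have h2 : Continuous fun z : D × (Icc (0:ℝ) 1 × Icc (0:ℝ) 1) => (z.1, (z.2.2 : ℝ)) := by
        fun_prop
      have h3 := (hcont i).comp h1
      have h4 := (hcont j).comp h2
      refine (hgraph.preimage h1).inter ((hgraph.preimage h2).inter (isClosed_eq ?_ ?_))
      · exact (continuous_subtype_val.comp continuous_fst).mul (continuous_const.mul h3)
      · exact continuous_const.mul (continuous_const.sub h4)
    convert isClosedMap_fst_of_compactSpace _ hclosed using 1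
    ext q
    simp only [mem_iUnion, mem_image, mem_ofPred_eq, Prod.exists, exists_and_right, exists_eq_right]
    constructor
    · intro h
      simp only [mem_inter_iff, mem_iUnion, mem_ofPred_eq] at h
      obtain ⟨u, hu, v, hv, h⟩ := h
      exact ⟨⟨u, hKI q q.2 hu⟩, ⟨v, hKI q q.2 hv⟩, hu, hv, h⟩
    · rintro ⟨u, v, hu, hv, h⟩
      simp only [mem_inter_iff, mem_iUnion, mem_ofPred_eq]
      exact ⟨u, hu, v, hv, h⟩
  · have hexp : -2 * Real.log 6 / Real.log r = Real.log (36 : ℕ) / -Real.log r := by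
      have h : Real.log (36 : ℕ) = 2 * Real.log 6 := by
        rw [show ((36 : ℕ) : ℝ) = 6 ^ 2 by norm_num, Real.log_pow]
        norm_num
      rw [h, div_neg, neg_mul, neg_div]
    rw [hexp]
    refine dimH_le_of_pow_cover (C := 6) (by norm_num) (by norm_num) hr.1 (by linarith [hr.2])
      (ι := fun k => (Fin k → Fin 6) × (Fin k → Fin 6))
      (fun k => by simp [← mul_pow])
      (fun k w => {q ∈ D | ∃ x ∈ cylinder (Spqr p q r) (K q) k w.1,
        ∃ y ∈ cylinder (Spqr p q r) (K q) k w.2,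
          1/5 ≤ x ∧ q * (p ^ m * x) = r ^ (n + 1) * (1 - y)}) ?_ ?_
    · rintro k w
      refine Metric.ediam_le_of_forall_dist_le ?_
      rintro q ⟨hq, x, hx, y, hy, hx5, h⟩ q' ⟨hq', x', hx', y', hy', -, h'⟩
      have hBA : r ^ (n + 1) ≤ 5 * r * p ^ m := by
        have := (div_lt_iff₀ hA).1 (hq.1.trans hq.2)
        linarith
      have hclose := abs_sub_le_of_mem_cylinder hr hp (hDr hq) (hDr hq') (hK q (hD36 hq))
        (hK q' (hD36 hq')) k
      exact abs_sub_le_of_overlap hr hA hBA hB.le (hDr hq') h h' hx5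
        (hclose w.1 x hx x' hx') (hclose w.2 y hy y' hy')
    · rintro k q ⟨hq, i, j, hi, -, u, hu, v, hv, h⟩
      have hKq := hK q (hD36 hq)
      obtain ⟨w, hw⟩ := hKq.exists_mem_cylinder k _ (hKq.image_subset i (mem_image_of_mem _ hu))
      obtain ⟨w', hw'⟩ := hKq.exists_mem_cylinder k _ (hKq.image_subset j (mem_image_of_mem _ hv))
      exact mem_iUnion.2 ⟨(w, w'), hq, _, hw, _, hw',
        one_fifth_le_Spqr hr (hD36 hq) (hKI q hq hu) hi, h⟩
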